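/- Let s ∈ S and let q be an s–goal path that is lexicographically minimal in (cost₂, cost₁) among all s–goal paths, and suppose additionally that cost₁(q) ≤ cost₁(r) for every s–goal path r (i.e., h₁(s) = ub₁(s): the first-objective lower bound coincides with the first cost of the second-objective-optimal path). Then q weakly dominates every s–goal path, and for every start–s path p, the concatenation p·q weakly dominates every start–goal path that has p as a prefix. Consequently, no start–goal extension of p offers a cost pair not weakly dominated by that of p·q. -/

import Mathlib

/-- A path from `u` to `v` in the directed graph with edge relation `E`:
a nonempty list of states starting at `u`, ending at `v`, with consecutive
states related by `E`. -/
def IsPath {S : Type*} (E : S → S → Prop) (u v : S) (l : List S) : Prop :=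
  l ≠ [] ∧ l.head? = some u ∧ l.getLast? = some v ∧ l.Chain' E

/-- The cost of a path: the sum of the edge costs `c` over consecutive pairs. -/
noncomputable def pathCost {S : Type*} (c : S → S → ℝ) (l : List S) : ℝ :=
  ((l.zip l.tail).map fun e => c e.1 e.2).sum

/-- The cost pair of a path. -/
noncomputable def costPair {S : Type*} (c₁ c₂ : S → S → ℝ) (l : List S) : ℝ × ℝ :=
  (pathCost c₁ l, pathCost c₂ l)

/-- `(a₁, a₂)` dominates `(b₁, b₂)` if `a₁ < b₁ ∧ a₂ ≤ b₂` or `a₁ = b₁ ∧ a₂ < b₂`. -/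
def Dominates (a b : ℝ × ℝ) : Prop :=
  (a.1 < b.1 ∧ a.2 ≤ b.2) ∨ (a.1 = b.1 ∧ a.2 < b.2)

/-- `(a₁, a₂)` weakly dominates `(b₁, b₂)` if `a₁ ≤ b₁ ∧ a₂ ≤ b₂`. -/
def WeaklyDominates (a b : ℝ × ℝ) : Prop :=
  a.1 ≤ b.1 ∧ a.2 ≤ b.2

/-- Concatenation of a path ending at `s` with a path starting at `s`. -/
def pathConcat {S : Type*} (p q : List S) : List S := p ++ q.tail

/-- The cost of a path is additive when the path is split at one of its states. -/
theorem pathCost_append_cons {S : Type*} (c : S → S → ℝ) (l : List S) (s : S) (t : List S) :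
    pathCost c (l ++ s :: t) = pathCost c (l ++ [s]) + pathCost c (s :: t) := by
  induction l with
  | nil => simp [pathCost]
  | cons a l ih =>
    cases l with
    | nil => simp [pathCost]
    | cons b l =>
      simp only [pathCost, List.cons_append, List.tail_cons, List.zip_cons_cons,
        List.map_cons, List.sum_cons] at ih ⊢
      rw [ih, add_assoc]

/-- if `q` is an s–goal path lexicographically minimal in
`(cost₂, cost₁)` and moreover `cost₁ q` is minimal among all s–goal paths
(i.e. `h₁(s) = ub₁(s)`), then `q` weakly dominates every s–goal path, and for
every start–s path `p`, the concatenation `p·q` weakly dominates every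
start–goal path extending `p`. -/
theorem terminal_node_not_expanded
    {S : Type*} (E : S → S → Prop) (c₁ c₂ : S → S → ℝ)
    (hnn : ∀ u v, E u v → 0 ≤ c₁ u v ∧ 0 ≤ c₂ u v)
    (start goal s : S)
    (q : List S) (hq : IsPath E s goal q)
    (hlex : ∀ r, IsPath E s goal r →
        pathCost c₂ q < pathCost c₂ r ∨
        (pathCost c₂ q = pathCost c₂ r ∧ pathCost c₁ q ≤ pathCost c₁ r))
    (hqmin₁ : ∀ r, IsPath E s goal r → pathCost c₁ q ≤ pathCost c₁ r) :
    (∀ r, IsPath E s goal r →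
        WeaklyDominates (costPair c₁ c₂ q) (costPair c₁ c₂ r)) ∧
    (∀ p, IsPath E start s p → ∀ P, IsPath E start goal P → p <+: P →
        WeaklyDominates (costPair c₁ c₂ (pathConcat p q)) (costPair c₁ c₂ P)) := by
  have hdom : ∀ r, IsPath E s goal r →
      WeaklyDominates (costPair c₁ c₂ q) (costPair c₁ c₂ r) := fun r hr =>
    ⟨hqmin₁ r hr, (hlex r hr).elim le_of_lt fun h => h.1.le⟩
  refine ⟨hdom, ?_⟩
  rintro p ⟨-, -, hlast, -⟩ _ ⟨-, -, hgoal, hchain⟩ ⟨t, rfl⟩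
  obtain ⟨l, rfl⟩ := List.getLast?_eq_some_iff.mp hlast
  obtain ⟨t', rfl⟩ := List.head?_eq_some_iff.mp hq.2.1
  rw [List.append_assoc, List.singleton_append] at hgoal hchain
  have hsuffix : IsPath E s goal (s :: t) :=
    ⟨List.cons_ne_nil s t, rfl, by simpa using hgoal, hchain.right_of_append⟩
  obtain ⟨h₁, h₂⟩ := hdom _ hsuffix
  simp only [WeaklyDominates, costPair, pathConcat, List.tail_cons, List.append_assoc,
    List.singleton_append, pathCost_append_cons _ l s t, pathCost_append_cons _ l s t'] at h₁ h₂ ⊢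
  exact ⟨by gcongr, by gcongr⟩
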